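/- arXiv:2407.05522 — 2 statements merged into one kernel-verified Lean document; each statement's English description precedes it below -/
import Mathlib

section
/- Let E be an ordered Banach space with normal positive cone E₊, let (S(t))_{t≥0} be a positive C₀-semigroup on E, let u̲ ≤ ū in E, let F : [u̲,ū] → E be continuous and increasing, and assume hypothesis (H): for all t ≥ 0, u̲ ≤ S(t)u̲ + ∫₀ᵗ S(s)F(u̲) ds and S(t)ū + ∫₀ᵗ S(s)F(ū) ds ≤ ū. Assume in addition that either E has order continuous norm or S(t) is a compact operator for every t > 0. Then for each u₀ ∈ [u̲,ū] there exist mild solutions u_min and u_max with values in [u̲,ū] and initial value u₀ such that every mild solution u with values in [u̲,ū] and initial value u₀ satisfies u_min(t) ≤ u(t) ≤ u_max(t) for all t ≥ 0. -/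
open MeasureTheory Filter Topology

noncomputable section

/-- A proper closed positive cone in a real normed space. -/
def IsProperCone {E : Type*} [NormedAddCommGroup E] [NormedSpace ℝ E] (P : Set E) : Prop :=
  IsClosed P ∧ (∀ x ∈ P, ∀ y ∈ P, x + y ∈ P) ∧
    (∀ t : ℝ, 0 ≤ t → ∀ x ∈ P, t • x ∈ P) ∧ (∀ x ∈ P, -x ∈ P → x = 0)

/-- The partial order induced by the cone `P`: `x ≤ y` iff `y - x ∈ P`. -/
def coneLE {E : Type*} [NormedAddCommGroup E] (P : Set E) (x y : E) : Prop := y - x ∈ P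

/-- The order interval `[a, b]` with respect to the cone `P`. -/
def orderInterval {E : Type*} [NormedAddCommGroup E] (P : Set E) (a b : E) : Set E :=
  {x | coneLE P a x ∧ coneLE P x b}

/-- The cone is normal iff every order interval is norm bounded. -/
def IsNormalCone {E : Type*} [NormedAddCommGroup E] (P : Set E) : Prop :=
  ∀ a b : E, ∃ C : ℝ, ∀ x ∈ orderInterval P a b, ‖x‖ ≤ C

/-- `E` has order continuous norm: every increasing sequence contained in some
order interval converges in norm. -/
def OrderContinuousNorm {E : Type*} [NormedAddCommGroup E] (P : Set E) : Prop :=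
  ∀ (x : ℕ → E) (a b : E), (∀ n, coneLE P (x n) (x (n + 1))) →
    (∀ n, x n ∈ orderInterval P a b) → ∃ l : E, Filter.Tendsto x Filter.atTop (nhds l)

/-- A C₀-semigroup on `E`. -/
def IsC0Semigroup {E : Type*} [NormedAddCommGroup E] [NormedSpace ℝ E]
    (S : ℝ → E →L[ℝ] E) : Prop :=
  S 0 = 1 ∧ (∀ s t : ℝ, 0 ≤ s → 0 ≤ t → S (s + t) = (S s).comp (S t)) ∧
    ∀ x : E, ContinuousOn (fun t => S t x) (Set.Ici 0)

/-- A positive C₀-semigroup with respect to the cone `P`. -/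
def IsPositiveSemigroup {E : Type*} [NormedAddCommGroup E] [NormedSpace ℝ E]
    (P : Set E) (S : ℝ → E →L[ℝ] E) : Prop :=
  IsC0Semigroup S ∧ ∀ t : ℝ, 0 ≤ t → ∀ x ∈ P, S t x ∈ P

/-- The fixed point map `G` associated with the initial value `u0`:
`G(u)(t) = S(t)u₀ + ∫₀ᵗ S(t−s)F(u(s)) ds`. -/
def fixedPointMap {E : Type*} [NormedAddCommGroup E] [NormedSpace ℝ E]
    (S : ℝ → E →L[ℝ] E) (F : E → E) (u0 : E) (u : ℝ → E) (t : ℝ) : E :=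
  S t u0 + ∫ s in (0:ℝ)..t, S (t - s) (F (u s))

/-- A mild solution with values in `[ua, ub]` and initial value `u0`. -/
def IsMildSolution {E : Type*} [NormedAddCommGroup E] [NormedSpace ℝ E]
    (P : Set E) (S : ℝ → E →L[ℝ] E) (F : E → E) (ua ub u0 : E) (u : ℝ → E) : Prop :=
  ContinuousOn u (Set.Ici 0) ∧ (∀ t : ℝ, 0 ≤ t → u t ∈ orderInterval P ua ub) ∧
    ∀ t : ℝ, 0 ≤ t → u t = fixedPointMap S F u0 u t

section Helpers

variable {E : Type*} [NormedAddCommGroup E] [NormedSpace ℝ E]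

/-- Semigroup extended to negative times. -/
def extS (S : ℝ → E →L[ℝ] E) (r : ℝ) : E →L[ℝ] E := S (max r 0)

/-- Convolution. -/
def convS (S : ℝ → E →L[ℝ] E) (f : ℝ → E) (t : ℝ) : E :=
  ∫ s in (0:ℝ)..t, extS S (t - s) (f s)

theorem coneLE_refl {P : Set E} (hP : IsProperCone P) (hne : P.Nonempty) (x : E) :
    coneLE P x x := by
  obtain ⟨p, hp⟩ := hne
  have := hP.2.2.1 0 le_rfl p hp
  simpa [coneLE] using this

theorem coneLE_trans {P : Set E} (hP : IsProperCone P) {x y z : E}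
    (h1 : coneLE P x y) (h2 : coneLE P y z) : coneLE P x z := by
  have := hP.2.1 _ h1 _ h2
  unfold coneLE
  convert this using 1
  abel

theorem coneLE_antisymm {P : Set E} (hP : IsProperCone P) {x y : E}
    (h1 : coneLE P x y) (h2 : coneLE P y x) : x = y := by
  have := hP.2.2.2 _ h1 (by simpa [coneLE] using h2)
  exact (sub_eq_zero.1 this).symm

theorem coneLE_add {P : Set E} (hP : IsProperCone P) {x y z w : E}
    (h1 : coneLE P x y) (h2 : coneLE P z w) : coneLE P (x + z) (y + w) := by
  have := hP.2.1 _ h1 _ h2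
  unfold coneLE
  convert this using 1
  abel

theorem coneLE_of_tendsto {P : Set E} (hP : IsProperCone P) {x y : ℕ → E} {a b : E}
    (hx : Tendsto x atTop (𝓝 a)) (hy : Tendsto y atTop (𝓝 b))
    (h : ∀ᶠ n in atTop, coneLE P (x n) (y n)) : coneLE P a b :=
  hP.1.mem_of_tendsto (hy.sub hx) h

theorem integral_mem_cone [CompleteSpace E] {P : Set E} (hP : IsProperCone P)
    (hne : P.Nonempty) {t : ℝ} (ht : 0 ≤ t) {f : ℝ → E}
    (hfi : IntervalIntegrable f volume 0 t) (hf : ∀ s ∈ Set.Ioc 0 t, f s ∈ P) :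
    (∫ s in (0:ℝ)..t, f s) ∈ P := by
  rcases ht.eq_or_lt with h | h
  · subst h
    obtain ⟨p, hp⟩ := hne
    have := hP.2.2.1 0 le_rfl p hp
    simpa using this
  · have hconv : Convex ℝ P := by
      intro x hx y hy a b ha hb _
      exact hP.2.1 _ (hP.2.2.1 a ha x hx) _ (hP.2.2.1 b hb y hy)
    rw [intervalIntegral.integral_of_le ht]
    have h1 := hconv.set_average_mem (μ := volume) (t := Set.Ioc 0 t) (f := f) hP.1
      (by simpa using h) (by simp) (by
        rw [ae_restrict_iff' measurableSet_Ioc]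
        exact Eventually.of_forall hf) ((intervalIntegrable_iff_integrableOn_Ioc_of_le ht).1 hfi)
    rw [setAverage_eq] at h1
    have h2 := hP.2.2.1 t ht _ h1
    rw [smul_smul] at h2
    simpa [Measure.real, ht, h.ne'] using h2

theorem extS_bound [CompleteSpace E] {S : ℝ → E →L[ℝ] E} (hS : IsC0Semigroup S) (R : ℝ) :
    ∃ M : ℝ, 0 ≤ M ∧ ∀ r ≤ R, ‖extS S r‖ ≤ M := by
  obtain ⟨C, hC⟩ := banach_steinhaus (ι := Set.Icc (0:ℝ) (max R 0))
    (g := fun i => S i.1) (by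
      intro x
      have hc : ContinuousOn (fun t => S t x) (Set.Icc (0:ℝ) (max R 0)) :=
        (hS.2.2 x).mono Set.Icc_subset_Ici_self
      obtain ⟨C, hC⟩ := isCompact_Icc.exists_bound_of_continuousOn hc
      exact ⟨C, fun i => hC i.1 i.2⟩)
  refine ⟨max C 0, le_max_right _ _, fun r hr => le_trans ?_ (le_max_left _ _)⟩
  exact hC ⟨max r 0, le_max_right _ _, max_le_max_right 0 hr⟩

theorem extS_continuous {S : ℝ → E →L[ℝ] E} (hS : IsC0Semigroup S) (x : E) :
    Continuous (fun r => extS S r x) :=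
  (hS.2.2 x).comp_continuous (continuous_id.max continuous_const)
    (fun r => Set.mem_Ici.2 (le_max_right _ _))

theorem extS_joint [CompleteSpace E] {S : ℝ → E →L[ℝ] E} (hS : IsC0Semigroup S) :
    Continuous (fun p : ℝ × E => extS S p.1 p.2) := by
  rw [continuous_iff_continuousAt]
  rintro ⟨r, x⟩
  obtain ⟨M, hM0, hM⟩ := extS_bound hS (r + 1)
  have h1 : Tendsto (fun p : ℝ × E => extS S p.1 x) (𝓝 (r, x)) (𝓝 (extS S r x)) :=
    ((extS_continuous hS x).comp continuous_fst).tendsto (r, x)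
  have h2 : Tendsto (fun p : ℝ × E => extS S p.1 (p.2 - x)) (𝓝 (r, x)) (𝓝 0) := by
    refine squeeze_zero_norm' (a := fun p : ℝ × E => M * ‖p.2 - x‖) ?_ ?_
    · have : ∀ᶠ p : ℝ × E in 𝓝 (r, x), p.1 < r + 1 :=
        (continuous_fst.tendsto (r, x)).eventually (gt_mem_nhds (by simp))
      filter_upwards [this] with p hp
      exact (extS S p.1).le_of_opNorm_le (hM _ hp.le) _
    · have : Continuous (fun p : ℝ × E => M * ‖p.2 - x‖) := by fun_prop
      simpa using this.tendsto (r, x)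
  have h3 := h1.add h2
  simp only [map_sub, add_sub_cancel, add_zero] at h3
  exact h3

theorem convS_meas [CompleteSpace E] {S : ℝ → E →L[ℝ] E} (hS : IsC0Semigroup S) {f : ℝ → E}
    (hf : StronglyMeasurable f) (t : ℝ) :
    StronglyMeasurable (fun s => extS S (t - s) (f s)) := by
  have h1 : StronglyMeasurable (fun s : ℝ => t - s) := by
    have : Continuous (fun s : ℝ => t - s) := by fun_prop
    exact this.stronglyMeasurable
  exact (extS_joint hS).comp_stronglyMeasurable (h1.prodMk hf)

theorem convS_integrable [CompleteSpace E] {S : ℝ → E →L[ℝ] E} (hS : IsC0Semigroup S)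
    {f : ℝ → E} {C : ℝ}
    (hf : StronglyMeasurable f) (hC : ∀ s, ‖f s‖ ≤ C) (t a b : ℝ) :
    IntervalIntegrable (fun s => extS S (t - s) (f s)) volume a b := by
  obtain ⟨M, hM0, hM⟩ := extS_bound hS (t - min a b)
  refine (intervalIntegrable_const (c := M * C)).mono_fun
    (convS_meas hS hf t).aestronglyMeasurable ?_
  rw [EventuallyLE, ae_restrict_iff' measurableSet_uIoc]
  refine Eventually.of_forall fun s hs => ?_
  have hs1 : min a b < s := hs.1
  refine le_trans ((extS S (t - s)).le_of_opNorm_le_of_le (hM _ (by linarith)) (hC s)) ?_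
  exact le_abs_self _

theorem convS_continuous [CompleteSpace E] {S : ℝ → E →L[ℝ] E} (hS : IsC0Semigroup S)
    {f : ℝ → E} {C : ℝ}
    (hf : StronglyMeasurable f) (hC : ∀ s, ‖f s‖ ≤ C) : Continuous (convS S f) := by
  rw [continuous_iff_continuousAt]
  intro t
  obtain ⟨M, hM0, hM⟩ := extS_bound hS (t + 1 - (min t 0 - 1))
  have key := intervalIntegral.continuousAt_parametric_primitive_of_dominated
    (μ := volume) (F := fun x s => extS S (x - s) (f s)) (fun _ => M * C)
    (min t 0 - 1) (max t 0 + 1) (a₀ := 0) (b₀ := t) (x₀ := t)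
    (fun x => (convS_meas hS hf x).aestronglyMeasurable)
    (by
      filter_upwards [gt_mem_nhds (show t < t + 1 by linarith)] with x hx
      rw [ae_restrict_iff' measurableSet_uIoc]
      refine Eventually.of_forall fun s hs => ?_
      rw [Set.uIoc_of_le (by have := min_le_max (a := t) (b := 0); linarith)] at hs
      exact (extS S (x - s)).le_of_opNorm_le_of_le (hM _ (by linarith [hs.1])) (hC s))
    intervalIntegrable_const
    (by
      refine Eventually.of_forall fun s => ?_
      have : Continuous (fun x : ℝ => x - s) := by fun_prop
      exact ((extS_continuous hS (f s)).comp this).continuousAt)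
    ⟨by linarith [min_le_right t 0], by linarith [le_max_right t 0]⟩
    ⟨by linarith [min_le_left t 0], by linarith [le_max_left t 0]⟩
    (by simp)
  have h2 : ContinuousAt (fun x : ℝ => (x, x)) t := by fun_prop
  exact ContinuousAt.comp (f := fun x : ℝ => (x, x)) (x := t) key h2

theorem convS_mono [CompleteSpace E] {P : Set E} {S : ℝ → E →L[ℝ] E} (hP : IsProperCone P)
    (hne : P.Nonempty) (hS : IsPositiveSemigroup P S) {f g : ℝ → E} {C D : ℝ}
    (hf : StronglyMeasurable f) (hC : ∀ s, ‖f s‖ ≤ C)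
    (hg : StronglyMeasurable g) (hD : ∀ s, ‖g s‖ ≤ D)
    (hfg : ∀ s, coneLE P (f s) (g s)) {t : ℝ} (ht : 0 ≤ t) :
    coneLE P (convS S f t) (convS S g t) := by
  unfold coneLE convS
  rw [← intervalIntegral.integral_sub (convS_integrable hS.1 hg hD t 0 t)
    (convS_integrable hS.1 hf hC t 0 t)]
  refine integral_mem_cone hP hne ht ((convS_integrable hS.1 hg hD t 0 t).sub
    (convS_integrable hS.1 hf hC t 0 t)) fun s _ => ?_
  rw [← map_sub]
  exact hS.2 _ (le_max_right _ _) _ (hfg s)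

theorem convS_tendsto [CompleteSpace E] {S : ℝ → E →L[ℝ] E} (hS : IsC0Semigroup S)
    {f : ℕ → ℝ → E} {g : ℝ → E} {C : ℝ}
    (hf : ∀ n, StronglyMeasurable (f n)) (hC : ∀ n s, ‖f n s‖ ≤ C)
    (hfg : ∀ s, Tendsto (fun n => f n s) atTop (𝓝 (g s))) {t : ℝ} (ht : 0 ≤ t) :
    Tendsto (fun n => convS S (f n) t) atTop (𝓝 (convS S g t)) := by
  obtain ⟨M, hM0, hM⟩ := extS_bound hS t
  refine intervalIntegral.tendsto_integral_filter_of_dominated_convergence (fun _ => M * C)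
    (Eventually.of_forall fun n => (convS_meas hS (hf n) t).aestronglyMeasurable)
    (Eventually.of_forall fun n => Eventually.of_forall fun s hs => ?_)
    intervalIntegrable_const
    (Eventually.of_forall fun s _ => ((extS S (t - s)).continuous.tendsto _).comp (hfg s))
  rw [Set.uIoc_of_le ht] at hs
  exact (extS S (t - s)).le_of_opNorm_le_of_le (hM _ (by linarith [hs.1])) (hC n s)

theorem convS_congr {S : ℝ → E →L[ℝ] E} {f g : ℝ → E} {t : ℝ} (ht : 0 ≤ t)
    (h : ∀ s, 0 ≤ s → f s = g s) :
    (∫ s in (0:ℝ)..t, S (t - s) (f s)) = convS S g t := by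
  refine intervalIntegral.integral_congr fun s hs => ?_
  rw [Set.uIcc_of_le ht] at hs
  simp only [extS]
  rw [h s hs.1, max_eq_left (by linarith [hs.2])]

theorem convS_const {S : ℝ → E →L[ℝ] E} {x : E} {t : ℝ} (ht : 0 ≤ t) :
    (∫ s in (0:ℝ)..t, S s x) = convS S (fun _ => x) t := by
  rw [← convS_congr (f := fun _ => x) ht (fun _ _ => rfl),
    intervalIntegral.integral_comp_sub_left (fun s => S s x) t]
  simp

/-- Approximate compactness. -/
theorem convS_totallyBounded [CompleteSpace E] {S : ℝ → E →L[ℝ] E} (hS : IsC0Semigroup S)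
    (hK : ∀ t : ℝ, 0 < t → IsCompactOperator (⇑(S t)))
    {f : ℕ → ℝ → E} {C : ℝ}
    (hf : ∀ n, StronglyMeasurable (f n)) (hC : ∀ n s, ‖f n s‖ ≤ C) {t : ℝ} (ht : 0 < t) :
    TotallyBounded (Set.range (fun n => convS S (f n) t)) := by
  obtain ⟨M, hM0, hM⟩ := extS_bound hS t
  have hC0 : 0 ≤ C := (norm_nonneg _).trans (hC 0 0)
  rw [Metric.totallyBounded_iff]
  intro ε hε
  obtain ⟨δ, hδ0, hδt, hδ⟩ : ∃ δ : ℝ, 0 < δ ∧ δ ≤ t ∧ M * C * δ < ε / 2 := by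
    have hMC : 0 ≤ M * C := mul_nonneg hM0 hC0
    refine ⟨min t (ε / 2 / (M * C + 1)), lt_min ht (by positivity), min_le_left _ _, ?_⟩
    calc M * C * min t (ε / 2 / (M * C + 1)) ≤ M * C * (ε / 2 / (M * C + 1)) := by
          gcongr; exact min_le_right _ _
      _ < ε / 2 := by
          rw [← mul_div_assoc, div_lt_iff₀ (by positivity)]
          nlinarith
  have hcomp := IsCompactOperator.isCompact_closure_image_closedBall
    (f := (S δ : E →ₗ[ℝ] E)) (hK δ hδ0) (M * C * t)
  have htb := (hcomp.totallyBounded).subset subset_closure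
  obtain ⟨A, hA, hcov⟩ := Metric.totallyBounded_iff.1 htb (ε / 2) (by positivity)
  refine ⟨A, hA, ?_⟩
  rintro _ ⟨n, rfl⟩
  have hsplit : convS S (f n) t = S δ (∫ s in (0:ℝ)..(t - δ), extS S (t - δ - s) (f n s))
      + ∫ s in (t - δ)..t, extS S (t - s) (f n s) := by
    rw [← ContinuousLinearMap.intervalIntegral_comp_comm _
      (convS_integrable hS (hf n) (hC n) _ _ _)]
    unfold convS
    rw [← intervalIntegral.integral_add_adjacent_intervals
      (convS_integrable hS (hf n) (hC n) t 0 (t - δ))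
      (convS_integrable hS (hf n) (hC n) t (t - δ) t)]
    congr 1
    refine intervalIntegral.integral_congr fun s hs => ?_
    rw [Set.uIcc_of_le (by linarith)] at hs
    have h1 : t - s = δ + (t - δ - s) := by ring
    simp only [extS]
    rw [max_eq_left (by linarith [hs.2]), max_eq_left (by linarith [hs.2]), h1,
      hS.2.1 _ _ hδ0.le (by linarith [hs.2])]
    simp
  have hin : ‖∫ s in (0:ℝ)..(t - δ), extS S (t - δ - s) (f n s)‖ ≤ M * C * t := by
    refine (intervalIntegral.norm_integral_le_of_norm_le_const (C := M * C) ?_).trans ?_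
    · intro s hs
      rw [Set.uIoc_of_le (by linarith)] at hs
      exact (extS S _).le_of_opNorm_le_of_le (hM _ (by linarith [hs.1])) (hC n s)
    · rw [sub_zero, abs_of_nonneg (by linarith)]
      have hMC : 0 ≤ M * C := mul_nonneg hM0 hC0
      gcongr
      linarith
  have hout : ‖∫ s in (t - δ)..t, extS S (t - s) (f n s)‖ ≤ M * C * δ := by
    refine (intervalIntegral.norm_integral_le_of_norm_le_const (C := M * C) ?_).trans ?_
    · intro s hs
      rw [Set.uIoc_of_le (by linarith)] at hs
      exact (extS S _).le_of_opNorm_le_of_le (hM _ (by linarith [hs.1])) (hC n s)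
    · rw [sub_sub_cancel, abs_of_nonneg hδ0.le]
  have hm := hcov ⟨_, mem_closedBall_zero_iff.2 hin, rfl⟩
  simp only [Set.mem_iUnion, exists_prop] at hm ⊢
  obtain ⟨y, hyA, hy⟩ := hm
  refine ⟨y, hyA, ?_⟩
  rw [Metric.mem_ball, dist_eq_norm] at hy ⊢
  simp only [ContinuousLinearMap.coe_coe] at hy
  rw [hsplit, add_sub_right_comm]
  exact (norm_add_le _ _).trans_lt (by linarith)

theorem monotone_tendsto [CompleteSpace E] {P : Set E} (hP : IsProperCone P)
    (hne : P.Nonempty) {x : ℕ → E}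
    (hx : ∀ n, coneLE P (x n) (x (n + 1))) (htb : TotallyBounded (Set.range x)) :
    ∃ l, Tendsto x atTop (𝓝 l) := by
  have hmono : ∀ m n, m ≤ n → coneLE P (x m) (x n) := by
    intro m n h
    induction n, h using Nat.le_induction with
    | base => exact coneLE_refl hP hne _
    | succ k _ ih => exact coneLE_trans hP ih (hx k)
  have hcpt : IsCompact (closure (Set.range x)) :=
    htb.closure.isCompact_of_isClosed isClosed_closure
  have hub : ∀ (φ : ℕ → ℕ) (a : E), Tendsto φ atTop atTop → Tendsto (x ∘ φ) atTop (𝓝 a) →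
      ∀ m, coneLE P (x m) a := by
    intro φ a hφ ha m
    refine coneLE_of_tendsto hP tendsto_const_nhds ha ?_
    filter_upwards [hφ.eventually_ge_atTop m] with k hk
    exact hmono _ _ hk
  obtain ⟨a, -, φ, hφ, ha⟩ := hcpt.tendsto_subseq (x := x)
    (fun n => subset_closure ⟨n, rfl⟩)
  refine ⟨a, tendsto_of_subseq_tendsto fun ns hns => ?_⟩
  obtain ⟨b, -, ψ, hψ, hb⟩ := hcpt.tendsto_subseq (x := x ∘ ns)
    (fun n => subset_closure ⟨_, rfl⟩)
  have h1 := hub φ a hφ.tendsto_atTop ha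
  have h2 := hub (ns ∘ ψ) b (hns.comp hψ.tendsto_atTop) hb
  have hab : a = b := coneLE_antisymm hP
    (coneLE_of_tendsto hP ha tendsto_const_nhds (Eventually.of_forall fun k => h2 _))
    (coneLE_of_tendsto hP hb tendsto_const_nhds (Eventually.of_forall fun k => h1 _))
  exact ⟨ψ, hab ▸ hb⟩

/-- Modified fixed point map. -/
def modG (S : ℝ → E →L[ℝ] E) (F : E → E) (u0 : E) (u : ℝ → E) (t : ℝ) : E :=
  extS S t u0 + convS S (fun s => F (u s)) (max t 0)

/-- Iterates. -/
def iterG (S : ℝ → E →L[ℝ] E) (F : E → E) (u0 ua : E) : ℕ → ℝ → E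
  | 0 => fun _ => ua
  | n + 1 => modG S F u0 (iterG S F u0 ua n)

theorem fixed_eq_modG {S : ℝ → E →L[ℝ] E} {F : E → E} {u0 : E} {u v : ℝ → E}
    (h : ∀ s, 0 ≤ s → u s = v s) {t : ℝ} (ht : 0 ≤ t) :
    fixedPointMap S F u0 u t = modG S F u0 v t := by
  unfold fixedPointMap modG
  rw [convS_congr (g := fun s => F (v s)) ht (fun s hs => by rw [h s hs])]
  simp only [extS]
  rw [max_eq_left ht]

theorem exists_minimal [CompleteSpace E]
    (P : Set E) (S : ℝ → E →L[ℝ] E) (F : E → E) (ua ub : E)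
    (hP : IsProperCone P) (hN : IsNormalCone P) (hS : IsPositiveSemigroup P S)
    (hab : coneLE P ua ub)
    (hFc : ContinuousOn F (orderInterval P ua ub))
    (hFm : ∀ x ∈ orderInterval P ua ub, ∀ y ∈ orderInterval P ua ub,
      coneLE P x y → coneLE P (F x) (F y))
    (hH : ∀ t : ℝ, 0 ≤ t →
      coneLE P ua (S t ua + ∫ s in (0:ℝ)..t, S s (F ua)) ∧
      coneLE P (S t ub + ∫ s in (0:ℝ)..t, S s (F ub)) ub)
    (halt : OrderContinuousNorm P ∨ ∀ t : ℝ, 0 < t → IsCompactOperator (⇑(S t)))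
    (u0 : E) (hu0 : u0 ∈ orderInterval P ua ub) :
      ∃ umin : ℝ → E, IsMildSolution P S F ua ub u0 umin ∧
        ∀ u : ℝ → E, IsMildSolution P S F ua ub u0 u →
          ∀ t : ℝ, 0 ≤ t → coneLE P (umin t) (u t) := by
  have hne : P.Nonempty := ⟨_, hab⟩
  have ha : ua ∈ orderInterval P ua ub := ⟨coneLE_refl hP hne _, hab⟩
  have hb : ub ∈ orderInterval P ua ub := ⟨hab, coneLE_refl hP hne _⟩
  obtain ⟨C, hC⟩ := hN (F ua) (F ub)
  have hFC : ∀ x ∈ orderInterval P ua ub, ‖F x‖ ≤ C := fun x hx =>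
    hC _ ⟨hFm _ ha _ hx hx.1, hFm _ hx _ hb hx.2⟩
  have hSm : ∀ (t : ℝ) (x y : E), coneLE P x y → coneLE P (extS S t x) (extS S t y) := by
    intro t x y h
    unfold coneLE
    rw [← map_sub]
    exact hS.2 _ (le_max_right _ _) _ h
  have hmeas : ∀ u : ℝ → E, Continuous u → (∀ s, u s ∈ orderInterval P ua ub) →
      StronglyMeasurable (fun s => F (u s)) := fun u hu hu' =>
    (hFc.comp_continuous hu hu').stronglyMeasurable
  -- `modG` is monotone
  have hGm : ∀ u v : ℝ → E, Continuous u → Continuous v →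
      (∀ s, u s ∈ orderInterval P ua ub) → (∀ s, v s ∈ orderInterval P ua ub) →
      (∀ s, coneLE P (u s) (v s)) → ∀ t, coneLE P (modG S F u0 u t) (modG S F u0 v t) := by
    intro u v hu hv hu' hv' huv t
    exact coneLE_add hP (coneLE_refl hP hne _)
      (convS_mono hP hne hS (hmeas u hu hu') (fun s => hFC _ (hu' s)) (hmeas v hv hv')
        (fun s => hFC _ (hv' s)) (fun s => hFm _ (hu' s) _ (hv' s) (huv s)) (le_max_right _ _))
  -- `modG` preserves the interval
  have hGI : ∀ u : ℝ → E, StronglyMeasurable (fun s => F (u s)) →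
      (∀ s, u s ∈ orderInterval P ua ub) →
      ∀ t, modG S F u0 u t ∈ orderInterval P ua ub := by
    intro u hu hu' t
    have ht := le_max_right t 0
    have hh := hH _ ht
    rw [convS_const ht, convS_const ht] at hh
    refine ⟨coneLE_trans hP hh.1 (coneLE_add hP (hSm t _ _ hu0.1) ?_),
      coneLE_trans hP (coneLE_add hP (hSm t _ _ hu0.2) ?_) hh.2⟩
    · exact convS_mono hP hne hS stronglyMeasurable_const (fun _ => le_rfl) hu
        (fun s => hFC _ (hu' s)) (fun s => hFm _ ha _ (hu' s) (hu' s).1) ht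
    · exact convS_mono hP hne hS hu (fun s => hFC _ (hu' s)) stronglyMeasurable_const
        (fun _ => le_rfl) (fun s => hFm _ (hu' s) _ hb (hu' s).2) ht
  -- `modG` gives continuous functions
  have hGc : ∀ u : ℝ → E, StronglyMeasurable (fun s => F (u s)) →
      (∀ s, u s ∈ orderInterval P ua ub) → Continuous (modG S F u0 u) := by
    intro u hu hu'
    exact (extS_continuous hS.1 u0).add ((convS_continuous hS.1 hu
      (fun s => hFC _ (hu' s))).comp (continuous_id.max continuous_const))
  set w := iterG S F u0 ua with hw
  have hwI : ∀ n, Continuous (w n) ∧ ∀ s, w n s ∈ orderInterval P ua ub := by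
    intro n
    induction n with
    | zero => exact ⟨continuous_const, fun _ => ha⟩
    | succ n ih =>
      have hm := hmeas _ ih.1 ih.2
      exact ⟨hGc _ hm ih.2, hGI _ hm ih.2⟩
  have hwmeas : ∀ n, StronglyMeasurable (fun s => F (w n s)) := fun n =>
    hmeas _ (hwI n).1 (hwI n).2
  have hwm : ∀ n s, coneLE P (w n s) (w (n + 1) s) := by
    intro n
    induction n with
    | zero => exact fun s => ((hwI 1).2 s).1
    | succ n ih => exact hGm _ _ (hwI n).1 (hwI (n+1)).1 (hwI n).2 (hwI (n+1)).2 ih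
  -- pointwise convergence
  have hconv : ∀ t, ∃ l, Tendsto (fun n => w n t) atTop (𝓝 l) := by
    intro t
    rcases halt with h | h
    · exact h _ ua ub (fun n => hwm n t) (fun n => (hwI n).2 t)
    · obtain ⟨l, hl⟩ : ∃ l, Tendsto (fun n => convS S (fun s => F (w n s)) (max t 0))
          atTop (𝓝 l) := by
        rcases le_or_gt t 0 with ht | ht
        · refine ⟨0, ?_⟩
          rw [max_eq_right ht]
          simp [convS]
        · rw [max_eq_left ht.le]
          refine monotone_tendsto hP hne (fun n => ?_)
            (convS_totallyBounded hS.1 h hwmeas (fun n s => hFC _ ((hwI n).2 s)) ht)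
          exact convS_mono hP hne hS (hwmeas n) (fun s => hFC _ ((hwI n).2 s))
            (hwmeas (n + 1)) (fun s => hFC _ ((hwI (n + 1)).2 s))
            (fun s => hFm _ ((hwI n).2 s) _ ((hwI (n+1)).2 s) (hwm n s)) ht.le
      refine ⟨extS S t u0 + l, (tendsto_add_atTop_iff_nat 1).1 ?_⟩
      exact tendsto_const_nhds.add hl
  choose v hv using hconv
  have hvI : ∀ t, v t ∈ orderInterval P ua ub := fun t =>
    ⟨coneLE_of_tendsto hP tendsto_const_nhds (hv t)
      (Eventually.of_forall fun n => ((hwI n).2 t).1),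
     coneLE_of_tendsto hP (hv t) tendsto_const_nhds
      (Eventually.of_forall fun n => ((hwI n).2 t).2)⟩
  have hFv : ∀ t, Tendsto (fun n => F (w n t)) atTop (𝓝 (F (v t))) := fun t =>
    (hFc (v t) (hvI t)).tendsto.comp
      (tendsto_nhdsWithin_iff.2 ⟨hv t, Eventually.of_forall fun n => (hwI n).2 t⟩)
  have hvmeas : StronglyMeasurable (fun s => F (v s)) :=
    stronglyMeasurable_of_tendsto atTop hwmeas (tendsto_pi_nhds.2 hFv)
  have hveq : ∀ t, v t = modG S F u0 v t := by
    intro t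
    refine tendsto_nhds_unique ((tendsto_add_atTop_iff_nat 1).2 (hv t)) ?_
    exact tendsto_const_nhds.add (convS_tendsto hS.1 hwmeas
      (fun n s => hFC _ ((hwI n).2 s)) hFv (le_max_right _ _))
  have hvc : Continuous v := by
    rw [funext hveq]
    exact hGc v hvmeas hvI
  refine ⟨v, ⟨hvc.continuousOn, fun t _ => hvI t, fun t ht => ?_⟩, ?_⟩
  · rw [fixed_eq_modG (fun _ _ => rfl) ht]
    exact hveq t
  · intro u hu t ht
    have huc : Continuous (fun s => u (max s 0)) :=
      hu.1.comp_continuous (continuous_id.max continuous_const)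
        (fun r => Set.mem_Ici.2 (le_max_right _ _))
    have huI : ∀ s, u (max s 0) ∈ orderInterval P ua ub := fun s => hu.2.1 _ (le_max_right _ _)
    have hle : ∀ n s, 0 ≤ s → coneLE P (w n s) (u s) := by
      intro n
      have hle' : ∀ s, coneLE P (w n (max s 0)) (u (max s 0)) := by
        induction n with
        | zero => exact fun s => (huI s).1
        | succ n ih =>
          intro s
          have hs := le_max_right s 0
          have e1 : u (max s 0) = modG S F u0 (fun r => u (max r 0)) (max s 0) := by
            rw [← fixed_eq_modG (u := u) (fun r hr => by rw [max_eq_left hr]) hs]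
            exact hu.2.2 _ hs
          have e2 : w (n + 1) (max s 0) = modG S F u0 (fun r => w n (max r 0)) (max s 0) := by
            rw [← fixed_eq_modG (u := w n) (fun r hr => by rw [max_eq_left hr]) hs,
              fixed_eq_modG (fun _ _ => rfl) hs]
            rfl
          rw [e1, e2]
          exact hGm _ _ ((hwI n).1.comp (continuous_id.max continuous_const)) huc
            (fun r => (hwI n).2 _) huI ih _
      intro s hs
      simpa [max_eq_left hs] using hle' s
    exact coneLE_of_tendsto hP (hv t) tendsto_const_nhds
      (Eventually.of_forall fun n => hle n t ht)

theorem coneLE_neg {P : Set E} {x y : E} : coneLE (-P) x y ↔ coneLE P y x := by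
  simp [coneLE]

theorem orderInterval_neg {P : Set E} {x y : E} :
    orderInterval (-P) x y = orderInterval P y x := by
  ext z
  simp only [orderInterval, Set.mem_setOf_eq, coneLE_neg]
  exact and_comm

end Helpers

/-- existence of minimal and maximal mild solutions for every initial
value in the order interval, assuming order continuous norm or compactness of the
semigroup. -/
theorem exists_minimal_and_maximal_mild_solution
    {E : Type*} [NormedAddCommGroup E] [NormedSpace ℝ E] [CompleteSpace E]
    (P : Set E) (S : ℝ → E →L[ℝ] E) (F : E → E) (ua ub : E)
    (hP : IsProperCone P) (hN : IsNormalCone P) (hS : IsPositiveSemigroup P S)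
    (hab : coneLE P ua ub)
    (hFc : ContinuousOn F (orderInterval P ua ub))
    (hFm : ∀ x ∈ orderInterval P ua ub, ∀ y ∈ orderInterval P ua ub,
      coneLE P x y → coneLE P (F x) (F y))
    (hH : ∀ t : ℝ, 0 ≤ t →
      coneLE P ua (S t ua + ∫ s in (0:ℝ)..t, S s (F ua)) ∧
      coneLE P (S t ub + ∫ s in (0:ℝ)..t, S s (F ub)) ub)
    (halt : OrderContinuousNorm P ∨ ∀ t : ℝ, 0 < t → IsCompactOperator (⇑(S t))) :
    ∀ u0 ∈ orderInterval P ua ub,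
      ∃ umin umax : ℝ → E,
        IsMildSolution P S F ua ub u0 umin ∧
        IsMildSolution P S F ua ub u0 umax ∧
        ∀ u : ℝ → E, IsMildSolution P S F ua ub u0 u →
          ∀ t : ℝ, 0 ≤ t → coneLE P (umin t) (u t) ∧ coneLE P (u t) (umax t) := by

  intro u0 hu0
  obtain ⟨v, hv, hv'⟩ := exists_minimal P S F ua ub hP hN hS hab hFc hFm hH halt u0 hu0
  obtain ⟨w, hw, hw'⟩ := exists_minimal (-P) S F ub ua
    ⟨hP.1.neg, fun x hx y hy => by
        have := hP.2.1 _ hx _ hy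
        rw [Set.mem_neg, neg_add]
        exact this,
      fun t ht x hx => by
        have := hP.2.2.1 t ht _ hx
        rw [Set.mem_neg, ← smul_neg]
        exact this,
      fun x hx hx' => by
        have := hP.2.2.2 _ hx hx'
        simpa using this⟩
    (fun a b => by
      rw [orderInterval_neg]
      exact hN b a)
    ⟨hS.1, fun t ht x hx => by
      rw [Set.mem_neg, ← map_neg]
      exact hS.2 t ht _ hx⟩
    (coneLE_neg.2 hab) (by rwa [orderInterval_neg])
    (by
      rw [orderInterval_neg]
      intro x hx y hy hxy
      exact coneLE_neg.2 (hFm _ hy _ hx (coneLE_neg.1 hxy)))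
    (fun t ht => ⟨coneLE_neg.2 (hH t ht).2, coneLE_neg.2 (hH t ht).1⟩)
    (halt.imp (fun h x a b hx hxI => by
      obtain ⟨l, hl⟩ := h (fun n => -x n) (-a) (-b)
        (fun n => by
          have := coneLE_neg.1 (hx n)
          unfold coneLE at this ⊢
          convert this using 1
          abel)
        (fun n => by
          have h1 := coneLE_neg.1 (hxI n).1
          have h2 := coneLE_neg.1 (hxI n).2
          unfold coneLE at h1 h2
          constructor
          · unfold coneLE
            convert h1 using 1
            abel
          · unfold coneLE
            convert h2 using 1
            abel)
      exact ⟨-l, by simpa using hl.neg⟩) id) u0 (by rwa [orderInterval_neg])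
  refine ⟨v, w, hv, ?_, fun u hu t ht => ⟨hv' u hu t ht, coneLE_neg.1 (hw' u ?_ t ht)⟩⟩
  · exact ⟨hw.1, fun t ht => orderInterval_neg (P := P) ▸ hw.2.1 t ht, hw.2.2⟩
  · exact ⟨hu.1, fun t ht => by rw [orderInterval_neg]; exact hu.2.1 t ht, hu.2.2⟩
end
end

section
/- Let E be an ordered Banach space with normal positive cone E₊, let (S(t))_{t≥0} be a positive C₀-semigroup on E, let u̲ ≤ ū in E, let F : [u̲,ū] → E be continuous and increasing, and assume hypothesis (H): for all t ≥ 0, u̲ ≤ S(t)u̲ + ∫₀ᵗ S(s)F(u̲) ds and S(t)ū + ∫₀ᵗ S(s)F(ū) ds ≤ ū. Assume either E has order continuous norm or S(t) is compact for every t > 0. Let U_min be the minimal mild solution with initial value u̲ and U_max the maximal mild solution with initial value ū. Then for every u₀ ∈ [u̲,ū] and every mild solution u with values in [u̲,ū] and initial value u₀, one has U_min(t) ≤ u(t) ≤ U_max(t) for all t ≥ 0. -/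
open MeasureTheory Filter Topology

noncomputable section

theorem aux_bound {E : Type*} [NormedAddCommGroup E] [NormedSpace ℝ E] [CompleteSpace E]
    {S : ℝ → E →L[ℝ] E} (hS : IsC0Semigroup S) (T : ℝ) :
    ∃ M : ℝ, 0 ≤ M ∧ ∀ t, 0 ≤ t → t ≤ T → ‖S t‖ ≤ M := by
  have h := banach_steinhaus (g := fun t : Set.Icc (0:ℝ) T => S t) (by
    intro x
    have hc : ContinuousOn (fun t => S t x) (Set.Icc 0 T) :=
      (hS.2.2 x).mono (fun t ht => ht.1)
    obtain ⟨C, hC⟩ := isCompact_Icc.exists_bound_of_continuousOn hc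
    exact ⟨C, fun i => hC i i.2⟩)
  obtain ⟨C, hC⟩ := h
  exact ⟨max C 0, le_max_right _ _, fun t h0 hT => (hC ⟨t, h0, hT⟩).trans (le_max_left _ _)⟩

theorem aux_joint {E : Type*} [NormedAddCommGroup E] [NormedSpace ℝ E] [CompleteSpace E]
    {S : ℝ → E →L[ℝ] E} (hS : IsC0Semigroup S) {g : ℝ → E} (hg : ContinuousOn g (Set.Ici 0))
    (t : ℝ) : ContinuousOn (fun s => S (t - s) (g s)) (Set.Icc 0 t) := by
  obtain ⟨M, hM0, hM⟩ := aux_bound hS t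
  intro s0 hs0
  have h1 : Tendsto (fun s => S (t - s) (g s0)) (𝓝[Set.Icc 0 t] s0) (𝓝 (S (t - s0) (g s0))) := by
    have : ContinuousOn (fun s => S (t - s) (g s0)) (Set.Icc 0 t) :=
      (hS.2.2 (g s0)).comp (f := fun s => t - s) (by fun_prop)
        (fun s hs => by simpa using hs.2)
    exact this s0 hs0
  have h2 : Tendsto (fun s => S (t - s) (g s - g s0)) (𝓝[Set.Icc 0 t] s0) (𝓝 0) := by
    have hgc : Tendsto g (𝓝[Set.Icc 0 t] s0) (𝓝 (g s0)) :=
      (hg.mono (fun s hs => hs.1)) s0 hs0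
    have h3 : Tendsto (fun s => M * ‖g s - g s0‖) (𝓝[Set.Icc 0 t] s0) (𝓝 0) := by
      have := ((hgc.sub_const (g s0)).norm).const_mul M
      simpa using this
    refine squeeze_zero_norm' ?_ h3
    filter_upwards [self_mem_nhdsWithin] with s hs
    exact (S (t - s)).le_of_opNorm_le (hM _ (by linarith [hs.2]) (by linarith [hs.1])) _
  have := h2.add h1
  simp only [map_sub, sub_add_cancel, zero_add] at this
  exact this

theorem aux_conv_cont {E : Type*} [NormedAddCommGroup E] [NormedSpace ℝ E] [CompleteSpace E]
    {S : ℝ → E →L[ℝ] E} (hS : IsC0Semigroup S) {g : ℝ → E} {C : ℝ}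
    (hC : ∀ s, 0 ≤ s → ‖g s‖ ≤ C)
    (hm : ∀ t, 0 ≤ t → AEStronglyMeasurable (fun s => S (t - s) (g s))
      (volume.restrict (Set.Ioc 0 t))) :
    ContinuousOn (fun t => ∫ s in (0:ℝ)..t, S (t - s) (g s)) (Set.Ici 0) := by
  intro t0 ht0
  have ht0' : (0:ℝ) ≤ t0 := ht0
  obtain ⟨M, hM0, hM⟩ := aux_bound hS (t0 + 1)
  have hC0 : 0 ≤ C := (norm_nonneg _).trans (hC 0 le_rfl)
  have key : ∀ t, 0 ≤ t → t ≤ t0 + 1 → ∫ s in (0:ℝ)..t, S (t - s) (g s) =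
      ∫ s in Set.Ioc 0 (t0+1), (Set.Ioc 0 t).indicator (fun s => S (t - s) (g s)) s := by
    intro t h0 hT
    rw [intervalIntegral.integral_of_le h0, setIntegral_indicator measurableSet_Ioc,
      Set.inter_eq_self_of_subset_right (Set.Ioc_subset_Ioc_right hT)]
  have hev : ∀ᶠ t in 𝓝[Set.Ici 0] t0, 0 ≤ t ∧ t ≤ t0 + 1 := by
    filter_upwards [self_mem_nhdsWithin,
      mem_nhdsWithin_of_mem_nhds (Iic_mem_nhds (show t0 < t0 + 1 by linarith))] with t h1 h2
    exact ⟨h1, h2⟩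
  unfold ContinuousWithinAt
  beta_reduce
  rw [key t0 ht0' (by linarith)]
  refine Tendsto.congr' (f₁ := fun t => ∫ s in Set.Ioc 0 (t0+1),
    (Set.Ioc 0 t).indicator (fun s => S (t - s) (g s)) s) ?_ ?_
  · filter_upwards [hev] with t ht
    exact (key t ht.1 ht.2).symm
  refine tendsto_integral_filter_of_dominated_convergence (fun _ => M * C) ?_ ?_ ?_ ?_
  · filter_upwards [hev] with t ht
    rw [aestronglyMeasurable_indicator_iff measurableSet_Ioc,
      Measure.restrict_restrict measurableSet_Ioc,
      Set.inter_eq_self_of_subset_left (Set.Ioc_subset_Ioc_right ht.2)]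
    exact hm t ht.1
  · filter_upwards [hev] with t ht
    refine Eventually.of_forall fun s => ?_
    by_cases hs : s ∈ Set.Ioc 0 t
    · rw [Set.indicator_of_mem hs]
      exact ((S (t - s)).le_of_opNorm_le (hM _ (by linarith [hs.2]) (by linarith [hs.1, ht.2])) _).trans
        (mul_le_mul_of_nonneg_left (hC s hs.1.le) hM0)
    · rw [Set.indicator_of_notMem hs]
      simpa using mul_nonneg hM0 hC0
  · exact integrable_const _
  · have hne : ∀ᵐ s ∂(volume.restrict (Set.Ioc 0 (t0+1))), s ≠ t0 :=
      ae_restrict_of_ae (Measure.ae_ne volume t0)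
    filter_upwards [hne, ae_restrict_mem measurableSet_Ioc] with s hs hs'
    rcases lt_or_gt_of_ne hs with h | h
    · have h1 : Tendsto (fun t => S (t - s) (g s)) (𝓝[Set.Ici 0] t0) (𝓝 (S (t0 - s) (g s))) := by
        have hcw := hS.2.2 (g s) (t0 - s) (by simpa using h.le)
        have hca : ContinuousAt (fun t => S t (g s)) (t0 - s) :=
          hcw.continuousAt (Ici_mem_nhds (by linarith))
        have : ContinuousAt (fun t => S (t - s) (g s)) t0 :=
          ContinuousAt.comp (f := fun t => t - s) (g := fun t => S t (g s)) hca (by fun_prop)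
        exact this.tendsto.mono_left nhdsWithin_le_nhds
      rw [Set.indicator_of_mem (show s ∈ Set.Ioc 0 t0 from ⟨hs'.1, h.le⟩)]
      refine h1.congr' ?_
      filter_upwards [mem_nhdsWithin_of_mem_nhds (Ioi_mem_nhds h)] with t ht
      rw [Set.indicator_of_mem (show s ∈ Set.Ioc 0 t from ⟨hs'.1, le_of_lt ht⟩)]
    · rw [Set.indicator_of_notMem (fun hh => absurd hh.2 (not_le.2 h))]
      refine tendsto_const_nhds.congr' ?_
      filter_upwards [mem_nhdsWithin_of_mem_nhds (Iio_mem_nhds h)] with t ht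
      rw [Set.indicator_of_notMem (fun hh => absurd hh.2 (not_le.2 ht))]

theorem aux_int_mem {E : Type*} [NormedAddCommGroup E] [NormedSpace ℝ E] [CompleteSpace E]
    {P : Set E} (hP : IsProperCone P) {f : ℝ → E} {t : ℝ} (ht : 0 ≤ t) (h0 : (0:E) ∈ P)
    (hf : ∀ s ∈ Set.Ioc 0 t, f s ∈ P) (hi : IntervalIntegrable f volume 0 t) :
    (∫ s in (0:ℝ)..t, f s) ∈ P := by
  rcases ht.eq_or_lt with rfl | ht'
  · simpa using h0
  have hconv : Convex ℝ P := fun x hx y hy a b ha hb _ =>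
    hP.2.1 _ (hP.2.2.1 a ha x hx) _ (hP.2.2.1 b hb y hy)
  have := hconv.set_average_mem (μ := volume) (t := Set.Ioc 0 t) (f := f) hP.1
    (by simpa using ht') (by simp)
    (by filter_upwards [ae_restrict_mem measurableSet_Ioc] with s hs using hf s hs)
    ((intervalIntegrable_iff_integrableOn_Ioc_of_le ht).1 hi)
  rw [setAverage_eq] at this
  have h2 := hP.2.2.1 t ht _ this
  rw [smul_smul] at h2
  have h3 : t * (volume.real (Set.Ioc 0 t))⁻¹ = 1 := by
    simp [ht, ht'.ne']
  rw [h3, one_smul] at h2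
  rwa [intervalIntegral.integral_of_le ht]

theorem aux_mono_compact {E : Type*} [NormedAddCommGroup E] [NormedSpace ℝ E]
    {P : Set E} (hP : IsProperCone P) {x : ℕ → E}
    (hx : ∀ m n, m ≤ n → x n - x m ∈ P) (hK : IsCompact (closure (Set.range x))) :
    ∃ l, Tendsto x atTop (𝓝 l) := by
  have hmem : ∀ n, x n ∈ closure (Set.range x) := fun n => subset_closure ⟨n, rfl⟩
  have ub : ∀ y, MapClusterPt y atTop x → ∀ n, y - x n ∈ P := by
    intro y hy n
    have hcl : IsClosed {z | z - x n ∈ P} := hP.1.preimage (by fun_prop)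
    exact hcl.mem_of_mapClusterPt hy ((eventually_ge_atTop n).mono fun m hm => hx n m hm)
  have lub : ∀ y y', MapClusterPt y atTop x → MapClusterPt y' atTop x → y - y' ∈ P := by
    intro y y' hy hy'
    have hcl : IsClosed {z | y - z ∈ P} := hP.1.preimage (by fun_prop)
    exact hcl.mem_of_mapClusterPt hy' (Eventually.of_forall fun m => ub y hy m)
  obtain ⟨l, -, hl⟩ := hK.exists_mapClusterPt (f := atTop) (u := x)
    (tendsto_principal.2 (Eventually.of_forall hmem))
  refine ⟨l, hK.tendsto_nhds_of_unique_mapClusterPt (Eventually.of_forall hmem) ?_⟩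
  intro y _ hy
  have := hP.2.2.2 (y - l) (lub y l hy hl) (by simpa using lub l y hl hy)
  exact sub_eq_zero.1 this

theorem aux_compact {E : Type*} [NormedAddCommGroup E] [NormedSpace ℝ E] [CompleteSpace E]
    {S : ℝ → E →L[ℝ] E} (hS : IsC0Semigroup S)
    (hcpt : ∀ t : ℝ, 0 < t → IsCompactOperator (⇑(S t)))
    {g : ℕ → ℝ → E} {C : ℝ} (hg : ∀ n, ContinuousOn (g n) (Set.Ici 0))
    (hC : ∀ n s, 0 ≤ s → ‖g n s‖ ≤ C) {t : ℝ} (ht : 0 < t) :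
    TotallyBounded (Set.range fun n => ∫ s in (0:ℝ)..t, S (t - s) (g n s)) := by
  obtain ⟨M, hM0, hM⟩ := aux_bound hS t
  have hC0 : 0 ≤ C := (norm_nonneg _).trans (hC 0 0 le_rfl)
  rw [Metric.totallyBounded_iff]
  intro ε hε
  obtain ⟨δ, hδ0, hδt, hδ⟩ : ∃ δ, 0 < δ ∧ δ ≤ t ∧ M * C * δ < ε / 2 := by
    have hpos : 0 < M * C + 1 := by positivity
    refine ⟨min t (ε / 4 / (M * C + 1)), by positivity, min_le_left _ _, ?_⟩
    have h1 : (M * C + 1) * min t (ε / 4 / (M * C + 1)) ≤ ε / 4 := by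
      calc _ ≤ (M * C + 1) * (ε / 4 / (M * C + 1)) :=
            mul_le_mul_of_nonneg_left (min_le_right _ _) hpos.le
        _ = ε / 4 := by field_simp
    have h2 : 0 < min t (ε / 4 / (M * C + 1)) := by positivity
    nlinarith
  have hK : TotallyBounded (S δ '' Metric.closedBall 0 (M * C * t)) :=
    ((IsCompactOperator.isCompact_closure_image_closedBall (f := (S δ).toLinearMap)
      (hcpt δ hδ0) (M * C * t)).totallyBounded).subset subset_closure
  obtain ⟨A, hAf, hA⟩ := Metric.totallyBounded_iff.1 hK (ε / 2) (by linarith)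
  refine ⟨A, hAf, ?_⟩
  rintro _ ⟨n, rfl⟩
  have hcont := aux_joint hS (hg n) t
  have hint : ∀ a b, 0 ≤ a → a ≤ b → b ≤ t →
      IntervalIntegrable (fun s => S (t - s) (g n s)) volume a b := by
    intro a b ha hab hb
    refine ContinuousOn.intervalIntegrable ?_
    rw [Set.uIcc_of_le hab]
    exact hcont.mono (Set.Icc_subset_Icc ha hb)
  have hsplit : ∫ s in (0:ℝ)..t, S (t - s) (g n s) =
      S δ (∫ s in (0:ℝ)..(t-δ), S (t - δ - s) (g n s)) + ∫ s in (t-δ)..t, S (t - s) (g n s) := by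
    rw [← intervalIntegral.integral_add_adjacent_intervals
      (hint 0 (t-δ) le_rfl (by linarith) (by linarith))
      (hint (t-δ) t (by linarith) (by linarith) le_rfl)]
    congr 1
    rw [← ContinuousLinearMap.intervalIntegral_comp_comm]
    · refine intervalIntegral.integral_congr fun s hs => ?_
      rw [Set.uIcc_of_le (by linarith)] at hs
      have := hS.2.1 δ (t - δ - s) hδ0.le (by linarith [hs.2])
      rw [show t - s = δ + (t - δ - s) by ring, this]; rfl
    · refine ContinuousOn.intervalIntegrable ?_
      rw [Set.uIcc_of_le (by linarith)]
      exact aux_joint hS (hg n) (t - δ)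
  have hw : ‖∫ s in (0:ℝ)..(t-δ), S (t - δ - s) (g n s)‖ ≤ M * C * t := by
    refine (intervalIntegral.norm_integral_le_of_norm_le_const (C := M * C) ?_).trans ?_
    · intro s hs
      rw [Set.uIoc_of_le (by linarith)] at hs
      exact ((S (t - δ - s)).le_of_opNorm_le
        (hM _ (by linarith [hs.2]) (by linarith [hs.1])) _).trans
        (mul_le_mul_of_nonneg_left (hC n s hs.1.le) hM0)
    · rw [abs_of_nonneg (by linarith)]
      exact mul_le_mul_of_nonneg_left (by linarith) (by positivity)
  have hr : ‖∫ s in (t-δ)..t, S (t - s) (g n s)‖ < ε / 2 := by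
    refine (intervalIntegral.norm_integral_le_of_norm_le_const (C := M * C) ?_).trans_lt ?_
    · intro s hs
      rw [Set.uIoc_of_le (by linarith)] at hs
      exact ((S (t - s)).le_of_opNorm_le
        (hM _ (by linarith [hs.2]) (by linarith [hs.1])) _).trans
        (mul_le_mul_of_nonneg_left (hC n s (by linarith [hs.1])) hM0)
    · rw [abs_of_nonneg (by linarith)]
      simpa using hδ
  have hmem := hA ⟨_, by simpa using hw, rfl⟩
  simp only [Set.mem_iUnion, Metric.mem_ball, exists_prop] at hmem ⊢
  obtain ⟨y, hy, hd⟩ := hmem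
  refine ⟨y, hy, ?_⟩
  rw [hsplit]
  rw [dist_eq_norm] at hd ⊢
  rw [add_sub_right_comm]
  exact (norm_add_le _ _).trans_lt (by linarith)

theorem aux_trans {E : Type*} [NormedAddCommGroup E] [NormedSpace ℝ E]
    {P : Set E} (hP : IsProperCone P) {x y z : E} (h1 : coneLE P x y) (h2 : coneLE P y z) :
    coneLE P x z := by
  have := hP.2.1 _ h1 _ h2
  unfold coneLE
  convert this using 1
  abel

theorem aux_ii {E : Type*} [NormedAddCommGroup E] [NormedSpace ℝ E] [CompleteSpace E]
    {S : ℝ → E →L[ℝ] E} (hS : IsC0Semigroup S) {g : ℝ → E} (hg : ContinuousOn g (Set.Ici 0))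
    {t : ℝ} (ht : 0 ≤ t) : IntervalIntegrable (fun s => S (t - s) (g s)) volume 0 t := by
  refine ContinuousOn.intervalIntegrable ?_
  rw [Set.uIcc_of_le ht]
  exact aux_joint hS hg t

theorem aux_G_mono {E : Type*} [NormedAddCommGroup E] [NormedSpace ℝ E] [CompleteSpace E]
    {P : Set E} {S : ℝ → E →L[ℝ] E} {F : E → E}
    (hP : IsProperCone P) (hS : IsPositiveSemigroup P S) {a b : E} (hab : coneLE P a b)
    {v w : ℝ → E} (hv : ContinuousOn (fun s => F (v s)) (Set.Ici 0))
    (hw : ContinuousOn (fun s => F (w s)) (Set.Ici 0))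
    (hvw : ∀ s, 0 ≤ s → coneLE P (F (v s)) (F (w s))) {t : ℝ} (ht : 0 ≤ t) :
    coneLE P (fixedPointMap S F a v t) (fixedPointMap S F b w t) := by
  have h0 : (0:E) ∈ P := by simpa using hP.2.2.1 0 le_rfl _ hab
  have h1 := hS.2 t ht _ hab
  have h2 : (∫ s in (0:ℝ)..t, (S (t - s) (F (w s)) - S (t - s) (F (v s)))) ∈ P := by
    refine aux_int_mem hP ht h0 ?_ ((aux_ii hS.1 hw ht).sub (aux_ii hS.1 hv ht))
    intro s hs
    rw [← map_sub]
    exact hS.2 _ (by linarith [hs.2]) _ (hvw s hs.1.le)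
  rw [intervalIntegral.integral_sub (aux_ii hS.1 hw ht) (aux_ii hS.1 hv ht)] at h2
  have := hP.2.1 _ h1 _ h2
  unfold coneLE fixedPointMap
  convert this using 1
  rw [map_sub]
  abel

/-- monotone iterates -/
def auxIter {E : Type*} [NormedAddCommGroup E] [NormedSpace ℝ E]
    (S : ℝ → E →L[ℝ] E) (F : E → E) (ua : E) : ℕ → ℝ → E
  | 0 => fun _ => ua
  | n + 1 => fixedPointMap S F ua (auxIter S F ua n)

theorem aux_lower
    {E : Type*} [NormedAddCommGroup E] [NormedSpace ℝ E] [CompleteSpace E]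
    (P : Set E) (S : ℝ → E →L[ℝ] E) (F : E → E) (ua ub : E)
    (hP : IsProperCone P) (hN : IsNormalCone P) (hS : IsPositiveSemigroup P S)
    (hab : coneLE P ua ub)
    (hFc : ContinuousOn F (orderInterval P ua ub))
    (hFm : ∀ x ∈ orderInterval P ua ub, ∀ y ∈ orderInterval P ua ub,
      coneLE P x y → coneLE P (F x) (F y))
    (hH : ∀ t : ℝ, 0 ≤ t →
      coneLE P ua (S t ua + ∫ s in (0:ℝ)..t, S s (F ua)))
    (halt : OrderContinuousNorm P ∨ ∀ t : ℝ, 0 < t → IsCompactOperator (⇑(S t)))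
    (Umin : ℝ → E)
    (hUmin : ∀ u : ℝ → E, IsMildSolution P S F ua ub ua u → ∀ t : ℝ, 0 ≤ t → coneLE P (Umin t) (u t)) :
    ∀ u0 ∈ orderInterval P ua ub, ∀ u : ℝ → E, IsMildSolution P S F ua ub u0 u →
      ∀ t : ℝ, 0 ≤ t → coneLE P (Umin t) (u t) := by
  intro u0 hu0 u hu
  have h0 : (0:E) ∈ P := by simpa using hP.2.2.1 0 le_rfl _ hab
  have hrefl : ∀ x, coneLE P x x := fun x => by simpa [coneLE] using h0
  have hua : ua ∈ orderInterval P ua ub := ⟨hrefl _, hab⟩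
  have hub : ub ∈ orderInterval P ua ub := ⟨hab, hrefl _⟩
  obtain ⟨C, hC⟩ := hN (F ua) (F ub)
  have hFC : ∀ x ∈ orderInterval P ua ub, ‖F x‖ ≤ C := fun x hx =>
    hC _ ⟨hFm _ hua _ hx hx.1, hFm _ hx _ hub hx.2⟩
  have hFcomp : ∀ w : ℝ → E, ContinuousOn w (Set.Ici 0) →
      (∀ t, 0 ≤ t → w t ∈ orderInterval P ua ub) →
      ContinuousOn (fun s => F (w s)) (Set.Ici 0) := fun w hw hw' =>
    hFc.comp hw (fun s hs => hw' s hs)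
  have hGc : ∀ g : ℝ → E, ContinuousOn g (Set.Ici 0) → ∀ t, 0 ≤ t →
      AEStronglyMeasurable (fun s => S (t - s) (g s)) (volume.restrict (Set.Ioc 0 t)) :=
    fun g hg t ht => (aux_ii hS.1 hg ht).1.aestronglyMeasurable
  have main : ∀ n, ContinuousOn (auxIter S F ua n) (Set.Ici 0) ∧
      (∀ t, 0 ≤ t → auxIter S F ua n t ∈ orderInterval P ua ub ∧
        coneLE P (auxIter S F ua n t) (u t) ∧
        coneLE P (auxIter S F ua n t) (auxIter S F ua (n + 1) t)) := by
    intro n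
    induction n with
    | zero =>
      refine ⟨continuousOn_const, fun t ht => ⟨hua, (hu.2.1 t ht).1, ?_⟩⟩
      have := hH t ht
      have h2 := intervalIntegral.integral_comp_sub_left (a := 0) (b := t)
        (fun s => S s (F ua)) t
      simp only [sub_self, sub_zero] at h2
      simp only [auxIter, fixedPointMap]
      rw [h2]
      exact this
    | succ n ih =>
      obtain ⟨ic, ih⟩ := ih
      have hFv := hFcomp _ ic (fun t ht => (ih t ht).1)
      have hc : ContinuousOn (auxIter S F ua (n+1)) (Set.Ici 0) := by
        refine (hS.1.2.2 ua).add ?_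
        exact aux_conv_cont hS.1 (fun s hs => hFC _ (ih s hs).1) (hGc _ hFv)
      have hle : ∀ t, 0 ≤ t → coneLE P (auxIter S F ua (n+1) t) (u t) := by
        intro t ht
        rw [hu.2.2 t ht]
        exact aux_G_mono hP hS hu0.1 hFv (hFcomp u hu.1 hu.2.1)
          (fun s hs => hFm _ (ih s hs).1 _ (hu.2.1 s hs) (ih s hs).2.1) ht
      have hmem : ∀ t, 0 ≤ t → auxIter S F ua (n+1) t ∈ orderInterval P ua ub := fun t ht =>
        ⟨aux_trans hP (ih t ht).1.1 (ih t ht).2.2, aux_trans hP (hle t ht) (hu.2.1 t ht).2⟩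
      refine ⟨hc, fun t ht => ⟨hmem t ht, hle t ht, ?_⟩⟩
      exact aux_G_mono hP hS (hrefl _) hFv (hFcomp _ hc hmem)
          (fun s hs => hFm _ (ih s hs).1 _ (hmem s hs) (ih s hs).2.2) ht
  have hFv : ∀ n, ContinuousOn (fun s => F (auxIter S F ua n s)) (Set.Ici 0) := fun n =>
    hFcomp _ (main n).1 (fun t ht => ((main n).2 t ht).1)
  have hmono : ∀ t, 0 ≤ t → ∀ m n, m ≤ n → auxIter S F ua n t - auxIter S F ua m t ∈ P := by
    intro t ht m n hmn
    induction n, hmn using Nat.le_induction with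
    | base => exact hrefl _
    | succ k _ ih => exact aux_trans hP ih ((main k).2 t ht).2.2
  have hlim : ∀ t, ∃ l, 0 ≤ t → Tendsto (fun n => auxIter S F ua n t) atTop (𝓝 l) := by
    intro t
    by_cases ht : 0 ≤ t
    swap
    · exact ⟨0, fun h => absurd h ht⟩
    suffices ∃ l, Tendsto (fun n => auxIter S F ua n t) atTop (𝓝 l) from
      this.imp fun l hl _ => hl
    rcases halt with ho | hcpt
    · exact ho _ ua ub (fun n => ((main n).2 t ht).2.2) (fun n => ((main n).2 t ht).1)
    rcases ht.eq_or_lt with rfl | ht'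
    · refine ⟨ua, tendsto_const_nhds.congr fun n => ?_⟩
      cases n with
      | zero => rfl
      | succ n => simp [auxIter, fixedPointMap, hS.1.1]
    have htb := aux_compact hS.1 hcpt hFv
      (fun n s hs => hFC _ ((main n).2 s hs).1) ht'
    obtain ⟨l, hl⟩ := aux_mono_compact hP
      (x := fun n => ∫ s in (0:ℝ)..t, S (t - s) (F (auxIter S F ua n s))) (by
        intro m n hmn
        have := hmono t ht (m+1) (n+1) (by omega)
        simpa [auxIter, fixedPointMap] using this)
      (htb.closure.isCompact_of_isClosed isClosed_closure)
    refine ⟨S t ua + l, (tendsto_add_atTop_iff_nat 1).1 ?_⟩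
    exact hl.const_add (S t ua)
  choose v hv using hlim
  have hclosed : IsClosed (orderInterval P ua ub) := by
    have h1 : IsClosed {x | x - ua ∈ P} := hP.1.preimage (by fun_prop)
    have h2 : IsClosed {x | ub - x ∈ P} := hP.1.preimage (by fun_prop)
    exact h1.inter h2
  have hvmem : ∀ t, 0 ≤ t → v t ∈ orderInterval P ua ub := fun t ht =>
    hclosed.mem_of_tendsto (hv t ht) (Eventually.of_forall fun n => ((main n).2 t ht).1)
  have hvle : ∀ t, 0 ≤ t → coneLE P (v t) (u t) := by
    intro t ht
    have h1 : IsClosed {x | u t - x ∈ P} := hP.1.preimage (by fun_prop)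
    exact h1.mem_of_tendsto (hv t ht) (Eventually.of_forall fun n => ((main n).2 t ht).2.1)
  have hFlim : ∀ s, 0 ≤ s → Tendsto (fun n => F (auxIter S F ua n s)) atTop (𝓝 (F (v s))) := by
    intro s hs
    refine (hFc (v s) (hvmem s hs)).tendsto.comp (tendsto_nhdsWithin_iff.2 ⟨hv s hs, ?_⟩)
    exact Eventually.of_forall fun n => ((main n).2 s hs).1
  have hptw : ∀ t, ∀ s ∈ Set.Ioc 0 t, Tendsto (fun n => S (t - s) (F (auxIter S F ua n s))) atTop
      (𝓝 (S (t - s) (F (v s)))) := fun t s hs =>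
    ((S (t - s)).continuous.tendsto _).comp (hFlim s hs.1.le)
  have hmeas : ∀ t, 0 ≤ t → AEStronglyMeasurable (fun s => S (t - s) (F (v s)))
      (volume.restrict (Set.Ioc 0 t)) := by
    intro t ht
    refine aestronglyMeasurable_of_tendsto_ae atTop (fun n => hGc _ (hFv n) t ht) ?_
    filter_upwards [ae_restrict_mem measurableSet_Ioc] with s hs using hptw t s hs
  have hfix : ∀ t, 0 ≤ t → v t = fixedPointMap S F ua v t := by
    intro t ht
    obtain ⟨M, hM0, hM⟩ := aux_bound hS.1 t
    have hI : Tendsto (fun n => ∫ s in (0:ℝ)..t, S (t - s) (F (auxIter S F ua n s))) atTop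
        (𝓝 (∫ s in (0:ℝ)..t, S (t - s) (F (v s)))) := by
      simp only [intervalIntegral.integral_of_le ht]
      refine tendsto_integral_of_dominated_convergence (fun _ => M * C)
        (fun n => hGc _ (hFv n) t ht) (integrable_const _) ?_ ?_
      · intro n
        filter_upwards [ae_restrict_mem measurableSet_Ioc] with s hs
        exact ((S (t - s)).le_of_opNorm_le (hM _ (by linarith [hs.2]) (by linarith [hs.1])) _).trans
          (mul_le_mul_of_nonneg_left (hFC _ ((main n).2 s hs.1.le).1) hM0)
      · filter_upwards [ae_restrict_mem measurableSet_Ioc] with s hs using hptw t s hs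
    exact tendsto_nhds_unique ((tendsto_add_atTop_iff_nat 1).2 (hv t ht)) (hI.const_add (S t ua))
  have hvc : ContinuousOn v (Set.Ici 0) := by
    have h1 : ContinuousOn (fixedPointMap S F ua v) (Set.Ici 0) :=
      (hS.1.2.2 ua).add (aux_conv_cont hS.1 (fun s hs => hFC _ (hvmem s hs)) hmeas)
    exact h1.congr (fun t ht => hfix t ht)
  intro t ht
  exact aux_trans hP (hUmin v ⟨hvc, hvmem, hfix⟩ t ht) (hvle t ht)

theorem aux_neg_le {E : Type*} [NormedAddCommGroup E] (P : Set E) (x y : E) :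
    coneLE P (-x) (-y) ↔ coneLE P y x := by
  unfold coneLE
  rw [neg_sub_neg]

theorem aux_neg_mem {E : Type*} [NormedAddCommGroup E] (P : Set E) (a b x : E) :
    x ∈ orderInterval P (-b) (-a) ↔ -x ∈ orderInterval P a b := by
  have h1 := aux_neg_le P b (-x)
  have h2 := aux_neg_le P (-x) a
  rw [neg_neg] at h1 h2
  exact (and_congr h1 h2).trans and_comm

theorem aux_neg_mild {E : Type*} [NormedAddCommGroup E] [NormedSpace ℝ E]
    {P : Set E} {S : ℝ → E →L[ℝ] E} {F : E → E} {ua ub u0 : E} {u : ℝ → E}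
    (h : IsMildSolution P S F ua ub u0 u) :
    IsMildSolution P S (fun x => - F (-x)) (-ub) (-ua) (-u0) (fun t => - u t) := by
  refine ⟨h.1.neg, fun t ht => (aux_neg_mem _ _ _ _).2 (by simpa using h.2.1 t ht), ?_⟩
  intro t ht
  have := h.2.2 t ht
  simp only [fixedPointMap, neg_neg, map_neg, intervalIntegral.integral_neg] at this ⊢
  rw [← neg_add, ← this]

/-- every mild solution with initial value in the order interval lies
between the minimal solution starting at `ua` and the maximal solution starting
at `ub`. -/
theorem mild_solutions_between_extremal_solutions
    {E : Type*} [NormedAddCommGroup E] [NormedSpace ℝ E] [CompleteSpace E]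
    (P : Set E) (S : ℝ → E →L[ℝ] E) (F : E → E) (ua ub : E)
    (hP : IsProperCone P) (hN : IsNormalCone P) (hS : IsPositiveSemigroup P S)
    (hab : coneLE P ua ub)
    (hFc : ContinuousOn F (orderInterval P ua ub))
    (hFm : ∀ x ∈ orderInterval P ua ub, ∀ y ∈ orderInterval P ua ub,
      coneLE P x y → coneLE P (F x) (F y))
    (hH : ∀ t : ℝ, 0 ≤ t →
      coneLE P ua (S t ua + ∫ s in (0:ℝ)..t, S s (F ua)) ∧
      coneLE P (S t ub + ∫ s in (0:ℝ)..t, S s (F ub)) ub)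
    (halt : OrderContinuousNorm P ∨ ∀ t : ℝ, 0 < t → IsCompactOperator (⇑(S t)))
    (Umin Umax : ℝ → E)
    (hUmin : IsMildSolution P S F ua ub ua Umin ∧
      ∀ u : ℝ → E, IsMildSolution P S F ua ub ua u → ∀ t : ℝ, 0 ≤ t → coneLE P (Umin t) (u t))
    (hUmax : IsMildSolution P S F ua ub ub Umax ∧
      ∀ u : ℝ → E, IsMildSolution P S F ua ub ub u → ∀ t : ℝ, 0 ≤ t → coneLE P (u t) (Umax t)) :
    ∀ u0 ∈ orderInterval P ua ub, ∀ u : ℝ → E, IsMildSolution P S F ua ub u0 u →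
      ∀ t : ℝ, 0 ≤ t → coneLE P (Umin t) (u t) ∧ coneLE P (u t) (Umax t) := by
  intro u0 hu0 u hu t ht
  refine ⟨aux_lower P S F ua ub hP hN hS hab hFc hFm (fun t ht => (hH t ht).1) halt Umin hUmin.2
    u0 hu0 u hu t ht, ?_⟩
  have := aux_lower P S (fun x => - F (-x)) (-ub) (-ua) hP hN hS ((aux_neg_le _ _ _).2 hab)
    (ContinuousOn.neg (hFc.comp continuousOn_neg (fun x hx => (aux_neg_mem _ _ _ _).1 hx)))
    (fun x hx y hy hxy => (aux_neg_le _ _ _).2 (hFm _ ((aux_neg_mem _ _ _ _).1 hy) _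
      ((aux_neg_mem _ _ _ _).1 hx) ((aux_neg_le _ _ _).2 hxy)))
    (fun t ht => by
      have h := (aux_neg_le _ _ _).2 (hH t ht).2
      simpa only [neg_neg, map_neg, intervalIntegral.integral_neg, neg_add] using h)
    halt (fun t => - Umax t)
    (fun w hw t ht => by
      have h := aux_neg_mild hw
      simp only [neg_neg] at h
      have h2 := (aux_neg_le _ _ _).2 (hUmax.2 _ h t ht)
      rwa [neg_neg] at h2)
    (-u0) ((aux_neg_mem _ _ _ _).2 (by simpa using hu0)) (fun t => - u t) (aux_neg_mild hu) t ht
  exact (aux_neg_le _ _ _).1 this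
end
end
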